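/- (Total variance bound, Corollary 1.) In a factored MDP in which the agent follows a deterministic policy π from initial state s_1, the occupancy-weighted sum of all per-step factored variances is bounded by H²: Σ_{h=1}^H Σ_{(s,a)∈S×𝒜} w_h(s,a) ( Σ_{i=1}^n σ²_i(P(·|s,a), V^π_{h+1}) + (1/m²) Σ_{i=1}^m σ²_{R,i}(s,a) ) ≤ H². -/

import Mathlib

open Finset

variable {n : ℕ}

/-- `p` is a probability mass function on a finite type. -/
def IsPmf {X : Type} [Fintype X] (p : X → ℝ) : Prop :=
  (∀ x, 0 ≤ p x) ∧ ∑ x, p x = 1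

/-- L1 distance between two real-valued functions on a finite type. -/
def l1dist {X : Type} [Fintype X] (p q : X → ℝ) : ℝ :=
  ∑ x, |p x - q x|

/-- Merge a choice of coordinates below `i`, the coordinate at `i`, and
coordinates above `i` into a full state. -/
def merge (S : Fin n → Type) (i : Fin n)
    (a : ∀ j : {j : Fin n // j < i}, S j.1) (b : S i)
    (c : ∀ j : {j : Fin n // i < j}, S j.1) : ∀ j, S j := fun j =>
  if h : j < i then a ⟨j, h⟩
  else if h' : i < j then c ⟨j, h'⟩
  else cast (congrArg S (le_antisymm (not_lt.mp h') (not_lt.mp h))).symm b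

/-- `G S p V i a b` : expectation of `V` over the coordinates above `i`
(drawn independently from `p j`), given values `a` below `i` and `b` at `i`. -/
def G (S : Fin n → Type) [∀ i, Fintype (S i)] (p : ∀ i, S i → ℝ)
    (V : (∀ i, S i) → ℝ) (i : Fin n)
    (a : ∀ j : {j : Fin n // j < i}, S j.1) (b : S i) : ℝ :=
  ∑ c : ∀ j : {j : Fin n // i < j}, S j.1,
    (∏ j, p j.1 (c j)) * V (merge S i a b c)

/-- The `i`-th factored conditional variance
`σ²_i(p, V) = E_{s[1:i-1]}[ Var_{s[i]}( E_{s[i+1:n]}[V(s)] ) ]`. -/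
def facVar (S : Fin n → Type) [∀ i, Fintype (S i)] (p : ∀ i, S i → ℝ)
    (V : (∀ i, S i) → ℝ) (i : Fin n) : ℝ :=
  ∑ a : ∀ j : {j : Fin n // j < i}, S j.1,
    (∏ j, p j.1 (a j)) *
      ((∑ b : S i, p i b * (G S p V i a b) ^ 2)
        - (∑ b : S i, p i b * G S p V i a b) ^ 2)

open MeasureTheory ProbabilityTheory

/-- Expectation of `f` under the product of the weights `p`. -/
def prodExp (S : Fin n → Type) [∀ i, Fintype (S i)] (p : ∀ i, S i → ℝ)
    (f : (∀ i, S i) → ℝ) : ℝ :=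
  ∑ s : ∀ i, S i, (∏ i, p i (s i)) * f s

/-- Keep the coordinates of `s` with index below `k` and take the others from `t`. -/
def keepBelow (S : Fin n → Type) (k : ℕ) (s t : ∀ i, S i) : ∀ i, S i :=
  fun j => if j.val < k then s j else t j

/-- Second moment of the conditional expectation of `V` given the first `k` coordinates. -/
def condSecondMoment (S : Fin n → Type) [∀ i, Fintype (S i)] (p : ∀ i, S i → ℝ)
    (V : (∀ i, S i) → ℝ) (k : ℕ) : ℝ :=
  prodExp S p fun s => (prodExp S p fun t => V (keepBelow S k s t)) ^ 2

theorem merge_of_lt (S : Fin n → Type) (i : Fin n)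
    (a : ∀ j : {j : Fin n // j < i}, S j.1) (b : S i)
    (c : ∀ j : {j : Fin n // i < j}, S j.1) {j : Fin n} (h : j < i) :
    merge S i a b c j = a ⟨j, h⟩ := by
  simp [merge, h]

theorem merge_of_gt (S : Fin n → Type) (i : Fin n)
    (a : ∀ j : {j : Fin n // j < i}, S j.1) (b : S i)
    (c : ∀ j : {j : Fin n // i < j}, S j.1) {j : Fin n} (h : i < j) :
    merge S i a b c j = c ⟨j, h⟩ := by
  simp [merge, h, h.not_gt]

theorem merge_self (S : Fin n → Type) (i : Fin n)
    (a : ∀ j : {j : Fin n // j < i}, S j.1) (b : S i)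
    (c : ∀ j : {j : Fin n // i < j}, S j.1) :
    merge S i a b c i = b := by
  simp [merge]

/-- Splitting a state at coordinate `i`. -/
def mergeEquiv (S : Fin n → Type) (i : Fin n) :
    ((∀ j : {j : Fin n // j < i}, S j.1) × S i × (∀ j : {j : Fin n // i < j}, S j.1)) ≃
      (∀ j, S j) where
  toFun x := merge S i x.1 x.2.1 x.2.2
  invFun s := (fun j => s j.1, s i, fun j => s j.1)
  left_inv := by
    rintro ⟨a, b, c⟩
    refine Prod.ext ?_ (Prod.ext ?_ ?_)
    · funext j
      exact merge_of_lt S i a b c j.2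
    · exact merge_self S i a b c
    · funext j
      exact merge_of_gt S i a b c j.2
  right_inv := by
    intro s
    funext j
    rcases lt_trichotomy j i with h | rfl | h
    · exact merge_of_lt S i _ _ _ h
    · exact merge_self S j _ _ _
    · exact merge_of_gt S i _ _ _ h

theorem prod_eq_prod_lt_mul_prod_gt (i : Fin n) (f : Fin n → ℝ) :
    ∏ j, f j = (∏ j : {j : Fin n // j < i}, f j) * (f i * ∏ j : {j : Fin n // i < j}, f j) := by
  rw [Finset.prod_subtype (Finset.univ.filter (· < i)) (by simp) f |>.symm,
    Finset.prod_subtype (Finset.univ.filter (i < ·)) (by simp) f |>.symm,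
    ← Finset.prod_insert (s := Finset.univ.filter (i < ·)) (by simp),
    ← Finset.prod_filter_mul_prod_filter_not Finset.univ (· < i)]
  congr 2
  ext j
  simp [le_iff_lt_or_eq, or_comm, eq_comm]

theorem prodExp_eq_sum_merge (S : Fin n → Type) [∀ i, Fintype (S i)] (p : ∀ i, S i → ℝ)
    (f : (∀ i, S i) → ℝ) (i : Fin n) :
    prodExp S p f = ∑ a : ∀ j : {j : Fin n // j < i}, S j.1, (∏ j, p j.1 (a j)) *
      ∑ b : S i, p i b * ∑ c : ∀ j : {j : Fin n // i < j}, S j.1,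
        (∏ j, p j.1 (c j)) * f (merge S i a b c) := by
  rw [prodExp, ← (mergeEquiv S i).sum_comp, Fintype.sum_prod_type]
  refine Finset.sum_congr rfl fun a _ => ?_
  rw [Fintype.sum_prod_type, Finset.mul_sum]
  refine Finset.sum_congr rfl fun b _ => ?_
  rw [Finset.mul_sum, Finset.mul_sum]
  refine Finset.sum_congr rfl fun c _ => ?_
  change (∏ j, p j (merge S i a b c j)) * f (merge S i a b c) = _
  rw [prod_eq_prod_lt_mul_prod_gt i, merge_self]
  have h₁ : ∀ j : {j : Fin n // j < i}, p j.1 (merge S i a b c j.1) = p j.1 (a j) :=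
    fun j => by rw [merge_of_lt S i a b c j.2]
  have h₂ : ∀ j : {j : Fin n // i < j}, p j.1 (merge S i a b c j.1) = p j.1 (c j) :=
    fun j => by rw [merge_of_gt S i a b c j.2]
  simp only [h₁, h₂]
  ring

theorem sum_prod_pmf_eq_one {ι : Type} [Fintype ι] [DecidableEq ι] {T : ι → Type}
    [∀ i, Fintype (T i)] {p : ∀ i, T i → ℝ} (hp : ∀ i, IsPmf (p i)) :
    ∑ s : ∀ i, T i, ∏ i, p i (s i) = 1 := by
  rw [← Fintype.prod_sum]
  exact Finset.prod_eq_one fun i _ => (hp i).2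

section
variable (S : Fin n → Type) [∀ i, Fintype (S i)] {p : ∀ i, S i → ℝ}

theorem prodExp_const (hp : ∀ i, IsPmf (p i)) (c : ℝ) : prodExp S p (fun _ => c) = c := by
  rw [prodExp, ← Finset.sum_mul, sum_prod_pmf_eq_one hp, one_mul]

theorem prodExp_mono (hp : ∀ i, IsPmf (p i)) {f g : (∀ i, S i) → ℝ} (h : ∀ s, f s ≤ g s) :
    prodExp S p f ≤ prodExp S p g :=
  Finset.sum_le_sum fun s _ =>
    mul_le_mul_of_nonneg_left (h s) (Finset.prod_nonneg fun i _ => (hp i).1 _)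

theorem prodExp_keepBelow_succ_merge (hp : ∀ i, IsPmf (p i)) (V : (∀ i, S i) → ℝ) (i : Fin n)
    (a : ∀ j : {j : Fin n // j < i}, S j.1) (b : S i)
    (c : ∀ j : {j : Fin n // i < j}, S j.1) :
    prodExp S p (fun t => V (keepBelow S (i.val + 1) (merge S i a b c) t)) = G S p V i a b := by
  have key : ∀ a' b' c',
      keepBelow S (i.val + 1) (merge S i a b c) (merge S i a' b' c') = merge S i a b c' := by
    intro a' b' c'
    funext j
    rcases lt_trichotomy j i with h | rfl | h
    · have : j.val < i.val + 1 := Nat.lt_succ_of_lt h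
      simp only [keepBelow, this, if_true, merge_of_lt S i _ _ _ h]
    · simp only [keepBelow, Nat.lt_succ_self, if_true, merge_self]
    · have : ¬ j.val < i.val + 1 := not_lt.mpr h
      simp only [keepBelow, this, if_false, merge_of_gt S i _ _ _ h]
  rw [prodExp_eq_sum_merge S p _ i]
  simp only [key]
  rw [← Finset.sum_mul, ← Finset.sum_mul, (hp i).2, sum_prod_pmf_eq_one fun j => hp j.1,
    one_mul, one_mul, G]

theorem prodExp_keepBelow_merge (hp : ∀ i, IsPmf (p i)) (V : (∀ i, S i) → ℝ) (i : Fin n)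
    (a : ∀ j : {j : Fin n // j < i}, S j.1) (b : S i)
    (c : ∀ j : {j : Fin n // i < j}, S j.1) :
    prodExp S p (fun t => V (keepBelow S i.val (merge S i a b c) t))
      = ∑ b : S i, p i b * G S p V i a b := by
  have key : ∀ a' b' c',
      keepBelow S i.val (merge S i a b c) (merge S i a' b' c') = merge S i a b' c' := by
    intro a' b' c'
    funext j
    rcases lt_trichotomy j i with h | rfl | h
    · have : j.val < i.val := h
      simp only [keepBelow, this, if_true, merge_of_lt S i _ _ _ h]
    · simp only [keepBelow, lt_irrefl, if_false, merge_self]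
    · have : ¬ j.val < i.val := not_lt.mpr h.le
      simp only [keepBelow, this, if_false, merge_of_gt S i _ _ _ h]
  rw [prodExp_eq_sum_merge S p _ i]
  simp only [key]
  rw [← Finset.sum_mul, sum_prod_pmf_eq_one fun j => hp j.1, one_mul]
  rfl

theorem facVar_eq_condSecondMoment_sub (hp : ∀ i, IsPmf (p i)) (V : (∀ i, S i) → ℝ)
    (i : Fin n) :
    facVar S p V i = condSecondMoment S p V (i.val + 1) - condSecondMoment S p V i.val := by
  rw [condSecondMoment, condSecondMoment, prodExp_eq_sum_merge S p _ i,
    prodExp_eq_sum_merge S p _ i, ← Finset.sum_sub_distrib, facVar]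
  refine Finset.sum_congr rfl fun a _ => ?_
  simp only [prodExp_keepBelow_succ_merge S hp, prodExp_keepBelow_merge S hp]
  simp only [← Finset.sum_mul, sum_prod_pmf_eq_one fun j : {j : Fin n // i < j} => hp j.1,
    (hp i).2, one_mul]
  ring

/-- Law of total variance along the coordinates of a product pmf. -/
theorem sum_facVar (hp : ∀ i, IsPmf (p i)) (V : (∀ i, S i) → ℝ) :
    ∑ i, facVar S p V i = prodExp S p (fun s => V s ^ 2) - prodExp S p V ^ 2 := by
  simp only [facVar_eq_condSecondMoment_sub S hp]
  rw [Fin.sum_univ_eq_sum_range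
      (fun k => condSecondMoment S p V (k + 1) - condSecondMoment S p V k),
    Finset.sum_range_sub]
  have h₀ : ∀ s t, keepBelow S 0 s t = t := fun s t => by funext j; simp [keepBelow]
  have hn : ∀ s t, keepBelow S n s t = s := fun s t => by funext j; simp [keepBelow]
  simp only [condSecondMoment, h₀, hn, prodExp_const S hp]

end

theorem integral_id_mem_Icc {μ : Measure ℝ} [IsProbabilityMeasure μ]
    (h : μ (Set.Icc (0 : ℝ) 1) = 1) : ∫ x, x ∂μ ∈ Set.Icc (0 : ℝ) 1 := by
  have hae : ∀ᵐ x ∂μ, x ∈ Set.Icc (0 : ℝ) 1 := (mem_ae_iff_prob_eq_one measurableSet_Icc).2 h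
  have hint : Integrable (fun x : ℝ => x) μ := Integrable.of_mem_Icc 0 1 aemeasurable_id hae
  refine ⟨integral_nonneg_of_ae (hae.mono fun x hx => hx.1), ?_⟩
  calc ∫ x, x ∂μ ≤ ∫ _, (1 : ℝ) ∂μ :=
        integral_mono_ae hint (integrable_const _) (hae.mono fun x hx => hx.2)
    _ = 1 := by simp

theorem variance_id_add_sq_integral_le_one {μ : Measure ℝ} [IsProbabilityMeasure μ]
    (h : μ (Set.Icc (0 : ℝ) 1) = 1) : variance id μ + (∫ x, x ∂μ) ^ 2 ≤ 1 := by
  have hae : ∀ᵐ x ∂μ, id x ∈ Set.Icc (0 : ℝ) 1 :=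
    (mem_ae_iff_prob_eq_one measurableSet_Icc).2 h
  have hv := variance_le_sub_mul_sub hae aemeasurable_id
  have hm := (integral_id_mem_Icc h).2
  simp only [id] at hv
  nlinarith

theorem sum_variance_add_sq_sum_le {ι : Type} (v μ : ι → ℝ) (hv : ∀ i, v i + μ i ^ 2 ≤ 1)
    (hμ : ∀ i, μ i ∈ Set.Icc (0 : ℝ) 1) (s : Finset ι) :
    ∑ i ∈ s, v i + (∑ i ∈ s, μ i) ^ 2 ≤ (s.card : ℝ) ^ 2 := by
  classical
  induction s using Finset.induction_on with
  | empty => simp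
  | insert i s hi ih =>
    rw [Finset.sum_insert hi, Finset.sum_insert hi, Finset.card_insert_of_notMem hi]
    have h₀ : 0 ≤ ∑ j ∈ s, μ j := Finset.sum_nonneg fun j _ => (hμ j).1
    have h₁ : ∑ j ∈ s, μ j ≤ s.card := by
      simpa using Finset.sum_le_sum fun j (_ : j ∈ s) => (hμ j).2
    have h₂ : μ i * ∑ j ∈ s, μ j ≤ 1 * s.card := mul_le_mul (hμ i).2 h₁ h₀ zero_le_one
    push_cast
    linarith [hv i]

/-- **Total variance bound (Corollary 1).** In a factored MDP in which the agent
follows the deterministic policy `π` from initial state `s₁`, the occupancy-weighted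
sum of all per-step factored variances is bounded by `H²`. -/
theorem total_variance_bound
    (n m H : ℕ) (hn : 1 ≤ n) (hm : 1 ≤ m) (hH : 1 ≤ H)
    (S : Fin n → Type) [∀ i, Fintype (S i)] [∀ i, Nonempty (S i)]
    [∀ i, DecidableEq (S i)]
    (A : Type) [Fintype A] [Nonempty A] [DecidableEq A]
    -- factored transition kernel: `P s a i` is a pmf on `S i`
    (P : (∀ i, S i) → A → ∀ i, S i → ℝ)
    (hP : ∀ s a i, IsPmf (P s a i))
    -- factored rewards: `R i s a` is a Borel probability measure supported in `[0,1]`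
    (R : Fin m → (∀ i, S i) → A → Measure ℝ)
    [∀ i s a, IsProbabilityMeasure (R i s a)]
    (hRsupp : ∀ i s a, (R i s a) (Set.Icc (0 : ℝ) 1) = 1)
    -- deterministic policy and initial state
    (π : ℕ → (∀ i, S i) → A)
    (s₁ : ∀ i, S i)
    -- value functions of the policy `π`
    (Vpi : ℕ → (∀ i, S i) → ℝ)
    (hVtop : ∀ s, Vpi (H + 1) s = 0)
    (hVrec : ∀ h, 1 ≤ h → h ≤ H → ∀ s,
      Vpi h s = (1 / (m : ℝ)) * (∑ i, ∫ x, x ∂(R i s (π h s)))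
        + ∑ s' : ∀ i, S i, (∏ i, P s (π h s) i (s' i)) * Vpi (h + 1) s')
    -- state-action occupancy measure of the policy `π` started at `s₁`
    (w : ℕ → (∀ i, S i) → A → ℝ)
    (hw1 : ∀ s a, w 1 s a = if s = s₁ ∧ a = π 1 s₁ then 1 else 0)
    (hwrec : ∀ h, 1 ≤ h → h < H → ∀ s' a',
      w (h + 1) s' a' = if a' = π (h + 1) s'
        then ∑ s : ∀ i, S i, ∑ a : A, w h s a * ∏ i, P s a i (s' i)
        else 0) :
    ∑ h ∈ Finset.Icc 1 H, ∑ s : ∀ i, S i, ∑ a : A,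
        w h s a * ((∑ i, facVar S (P s a) (Vpi (h + 1)) i)
          + (1 / (m : ℝ) ^ 2) * ∑ i, variance id (R i s a))
      ≤ (H : ℝ) ^ 2 := by
  have hm' : (0 : ℝ) < m := by exact_mod_cast hm
  set r : ℕ → (∀ i, S i) → ℝ := fun h s => (1 / (m : ℝ)) * ∑ i, ∫ x, x ∂(R i s (π h s)) with hr
  have hmean : ∀ i s a, ∫ x, x ∂(R i s a) ∈ Set.Icc (0 : ℝ) 1 :=
    fun i s a => integral_id_mem_Icc (hRsupp i s a)
  have hr₀ : ∀ h s, 0 ≤ r h s := fun h s =>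
    mul_nonneg (by positivity) (Finset.sum_nonneg fun i _ => (hmean i _ _).1)
  have hr₁ : ∀ h s, r h s ≤ 1 := by
    intro h s
    have : ∑ i, ∫ x, x ∂(R i s (π h s)) ≤ m := by
      simpa using Finset.sum_le_sum fun i (_ : i ∈ Finset.univ) => (hmean i s (π h s)).2
    simp only [hr]
    rw [one_div_mul_eq_div, div_le_one hm']
    exact this
  have hrvar : ∀ h s,
      (1 / (m : ℝ) ^ 2) * ∑ i, variance id (R i s (π h s)) + r h s ^ 2 ≤ 1 := by
    intro h s
    have := sum_variance_add_sq_sum_le (fun i => variance id (R i s (π h s)))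
      (fun i => ∫ x, x ∂(R i s (π h s)))
      (fun i => variance_id_add_sq_integral_le_one (hRsupp i s _)) (fun i => hmean i s _)
      Finset.univ
    rw [Finset.card_univ, Fintype.card_fin] at this
    simp only [hr]
    rw [mul_pow, div_pow, one_pow, ← mul_add, one_div_mul_eq_div, div_le_one (by positivity)]
    exact this
  have hV : ∀ d h : ℕ, 1 ≤ h → h + d = H + 1 → ∀ s, 0 ≤ Vpi h s ∧ Vpi h s ≤ d := by
    intro d
    induction d with
    | zero =>
      intro h _ hd s
      obtain rfl : h = H + 1 := by omega
      simp [hVtop]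
    | succ d ih =>
      intro h h1 hd s
      have hb := ih (h + 1) (by omega) (by omega)
      have h₀ := prodExp_mono S (hP s (π h s)) fun t => (hb t).1
      have h₁ := prodExp_mono S (hP s (π h s)) fun t => (hb t).2
      rw [prodExp_const S (hP s (π h s))] at h₀ h₁
      have hrec : Vpi h s = r h s + prodExp S (P s (π h s)) (Vpi (h + 1)) :=
        hVrec h h1 (by omega) s
      rw [hrec]
      push_cast
      exact ⟨add_nonneg (hr₀ h s) h₀, by linarith [hr₁ h s]⟩
  set U : ℕ → (∀ i, S i) → ℝ := fun h s => ((H : ℝ) + 1 - h) ^ 2 - Vpi h s ^ 2 with hU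
  have hstep : ∀ h, 1 ≤ h → h ≤ H → ∀ s,
      (∑ i, facVar S (P s (π h s)) (Vpi (h + 1)) i)
          + (1 / (m : ℝ) ^ 2) * ∑ i, variance id (R i s (π h s))
        ≤ U h s - prodExp S (P s (π h s)) (U (h + 1)) := by
    intro h h1 hH' s
    have hb := hV (H - h) (h + 1) (by omega) (by omega)
    have hcast : ((H - h : ℕ) : ℝ) = (H : ℝ) - h := by push_cast [hH']; ring
    have h₀ := prodExp_mono S (hP s (π h s)) fun t => (hb t).1
    have h₁ := prodExp_mono S (hP s (π h s)) fun t => (hb t).2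
    rw [prodExp_const S (hP s (π h s))] at h₀ h₁
    have hrec : Vpi h s = r h s + prodExp S (P s (π h s)) (Vpi (h + 1)) := hVrec h h1 hH' s
    have hEU : prodExp S (P s (π h s)) (U (h + 1))
        = ((H : ℝ) - h) ^ 2 - prodExp S (P s (π h s)) (fun t => Vpi (h + 1) t ^ 2) := by
      have hc := prodExp_const S (hP s (π h s)) (((H : ℝ) - h) ^ 2)
      rw [← hc]
      simp only [prodExp, hU, mul_sub, Finset.sum_sub_distrib, Nat.cast_add, Nat.cast_one,
        add_sub_add_right_eq_sub]
    have hprod : r h s * prodExp S (P s (π h s)) (Vpi (h + 1)) ≤ 1 * ((H : ℝ) - h) :=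
      mul_le_mul (hr₁ h s) (hcast ▸ h₁) h₀ zero_le_one
    rw [sum_facVar S (hP s (π h s)), hEU]
    simp only [hU]
    rw [hrec]
    linarith [hrvar h s]
  have hw₀ : ∀ h, 1 ≤ h → h ≤ H → ∀ s a, 0 ≤ w h s a := by
    intro h h1
    induction h, h1 using Nat.le_induction with
    | base => intro _ s a; rw [hw1]; split_ifs <;> norm_num
    | succ h h1 ih =>
      intro hH' s a
      rw [hwrec h h1 (by omega)]
      split_ifs
      · exact Finset.sum_nonneg fun t _ => Finset.sum_nonneg fun b _ =>
          mul_nonneg (ih (by omega) t b) (Finset.prod_nonneg fun i _ => (hP t b i).1 _)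
      · exact le_rfl
  have hwπ : ∀ h, 1 ≤ h → h ≤ H → ∀ s a, a ≠ π h s → w h s a = 0 := by
    intro h h1 hH' s a ha
    obtain rfl | ⟨k, hk, rfl⟩ : h = 1 ∨ ∃ k, 1 ≤ k ∧ h = k + 1 := by
      rcases h with _ | _ | k
      · omega
      · exact Or.inl rfl
      · exact Or.inr ⟨k + 1, by omega, rfl⟩
    · rw [hw1, if_neg]
      rintro ⟨rfl, h'⟩
      exact ha h'
    · rw [hwrec k hk (by omega), if_neg ha]
  set N : ℕ → ℝ := fun h => ∑ s, ∑ a, w h s a * prodExp S (P s a) (U (h + 1)) with hN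
  have hocc : ∀ h, 1 ≤ h → h ≤ H →
      ∑ s, ∑ a, w h s a * ((∑ i, facVar S (P s a) (Vpi (h + 1)) i)
          + (1 / (m : ℝ) ^ 2) * ∑ i, variance id (R i s a))
        ≤ ∑ s, ∑ a, w h s a * U h s - N h := by
    intro h h1 hH'
    simp only [hN, ← Finset.sum_sub_distrib, ← mul_sub]
    refine Finset.sum_le_sum fun s _ => Finset.sum_le_sum fun a _ => ?_
    by_cases ha : a = π h s
    · subst ha
      exact mul_le_mul_of_nonneg_left (hstep h h1 hH' s) (hw₀ h h1 hH' s _)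
    · simp [hwπ h h1 hH' s a ha]
  have hNsucc : ∀ h, 1 ≤ h → h < H → ∑ s, ∑ a, w (h + 1) s a * U (h + 1) s = N h := by
    intro h h1 hH'
    simp only [hwrec h h1 hH', ite_mul, zero_mul, Finset.sum_ite_eq', Finset.mem_univ, if_true,
      hN, prodExp, Finset.mul_sum, Finset.sum_mul]
    rw [Finset.sum_comm]
    refine Finset.sum_congr rfl fun s _ => ?_
    rw [Finset.sum_comm]
    simp only [mul_assoc]
  have htel : ∀ k, 1 ≤ k → k ≤ H →
      ∑ h ∈ Finset.Icc 1 k, ∑ s, ∑ a, w h s a * ((∑ i, facVar S (P s a) (Vpi (h + 1)) i)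
          + (1 / (m : ℝ) ^ 2) * ∑ i, variance id (R i s a)) ≤ (H : ℝ) ^ 2 - N k := by
    intro k hk
    induction k, hk using Nat.le_induction with
    | base =>
      intro h1
      have h₁ : ∑ s, ∑ a, w 1 s a * U 1 s = U 1 s₁ := by
        simp [hw1, ite_and]
      have h₂ := hocc 1 le_rfl h1
      rw [h₁] at h₂
      rw [Finset.Icc_self, Finset.sum_singleton]
      have h₃ : U 1 s₁ ≤ (H : ℝ) ^ 2 := by
        simp only [hU, Nat.cast_one, add_sub_cancel_right]
        linarith [sq_nonneg (Vpi 1 s₁)]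
      linarith
    | succ k hk ih =>
      intro hkH
      rw [Finset.sum_Icc_succ_top (by omega)]
      have h₂ := hocc (k + 1) (by omega) hkH
      rw [hNsucc k hk (by omega)] at h₂
      linarith [ih (by omega)]
  have hNH : N H = 0 := by
    simp [hN, hU, prodExp, hVtop]
  simpa [hNH] using htel H hH le_rfl
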